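/- arXiv:1907.07297 — 2 statements merged into one kernel-verified Lean document; each statement's English description precedes it below -/
import Mathlib

section
/- Let p be a prime, R a commutative ring of characteristic p, and 𝔞 an ideal of R generated by r ≥ 1 elements. Then for every real number λ ≥ r one has τ(𝔞^λ) = 𝔞 · τ(𝔞^{λ−1}). (Skoda's theorem for test ideals, Proposition 2.5(b).) -/
/-- A `p^{-e}`-linear map on `R`: an additive map `φ : R → R` with
`φ (r^{p^e} * x) = r * φ x`. -/
def IsCartierLinear (p e : ℕ) {R : Type*} [CommRing R] (φ : R →+ R) : Prop :=
  ∀ r x : R, φ (r ^ p ^ e * x) = r * φ x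

/-- `C^e · I`: the ideal generated by all `φ x` with `φ` a `p^{-e}`-linear map and `x ∈ I`. -/
def cartierIdeal (p e : ℕ) {R : Type*} [CommRing R] (I : Ideal R) : Ideal R :=
  Ideal.span {y | ∃ φ : R →+ R, IsCartierLinear p e φ ∧ ∃ x ∈ I, φ x = y}

/-- The test ideal `τ(𝔞^λ)`: the supremum over `e ≥ 1` of `C^e · 𝔞^{⌈λ p^e⌉}`. -/
noncomputable def testIdeal (p : ℕ) {R : Type*} [CommRing R] (𝔞 : Ideal R) (lam : ℝ) : Ideal R :=
  ⨆ (e : ℕ) (_ : 1 ≤ e), cartierIdeal p e (𝔞 ^ ⌈lam * (p : ℝ) ^ e⌉₊)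


open scoped Pointwise in
theorem skodaAux_monomial {R : Type*} [CommRing R] {r : ℕ} (f : Fin r → R) (n : ℕ) :
    ∀ x ∈ (Set.range f) ^ n, ∃ a : Fin r → ℕ, ∑ i, a i = n ∧ x = ∏ i, f i ^ a i := by
  induction n with
  | zero =>
    intro x hx
    refine ⟨fun _ => 0, by simp, ?_⟩
    simpa using hx
  | succ n ih =>
    intro x hx
    rw [pow_succ, Set.mem_mul] at hx
    obtain ⟨y, hy, z, ⟨j, rfl⟩, rfl⟩ := hx
    obtain ⟨a, ha, rfl⟩ := ih y hy
    refine ⟨fun i => a i + if i = j then 1 else 0, ?_, ?_⟩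
    · simp [Finset.sum_add_distrib, ha]
    · simp only [pow_add, Finset.prod_mul_distrib]
      congr 1
      simp [pow_ite]

open scoped Pointwise in
/-- Pigeonhole: large powers of `𝔞` factor through `q`-th powers of elements. -/
theorem skodaAux_pow_le {R : Type*} [CommRing R] {r : ℕ} (hr : 1 ≤ r) (f : Fin r → R)
    (q m : ℕ) (hq : 1 ≤ q) (h : r * q ≤ m + q) :
    (Ideal.span (Set.range f)) ^ (m + q) ≤
      Ideal.span {y | ∃ g ∈ Ideal.span (Set.range f), y = g ^ q} *
        (Ideal.span (Set.range f)) ^ m := by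
  have e : (Ideal.span (Set.range f)) ^ (m + q) = Ideal.span ((Set.range f) ^ (m + q)) :=
    Submodule.span_pow _ _
  rw [e, Ideal.span_le]
  intro x hx
  obtain ⟨a, ha, rfl⟩ := skodaAux_monomial f _ x hx
  have : ∃ i, q ≤ a i := by
    by_contra! hc
    have : ∑ i, a i < ∑ _i : Fin r, q :=
      Finset.sum_lt_sum_of_nonempty ⟨⟨0, hr⟩, Finset.mem_univ _⟩ (fun i _ => hc i)
    simp at this
    omega
  obtain ⟨j, hj⟩ := this
  have hs := Finset.add_sum_erase Finset.univ a (Finset.mem_univ j)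
  rw [← Finset.mul_prod_erase Finset.univ _ (Finset.mem_univ j)]
  obtain ⟨c, hc⟩ := Nat.exists_eq_add_of_le hj
  rw [hc, pow_add, mul_assoc]
  have hf : ∀ i, f i ∈ Ideal.span (Set.range f) := fun i => Ideal.subset_span ⟨i, rfl⟩
  refine Ideal.mul_mem_mul (Ideal.subset_span ⟨f j, hf j, rfl⟩) ?_
  have hm : m = c + ∑ i ∈ Finset.univ.erase j, a i := by omega
  rw [hm, pow_add, ← Finset.prod_pow_eq_pow_sum]
  exact Ideal.mul_mem_mul (Ideal.pow_mem_pow (hf j) _)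
    (Ideal.prod_mem_prod fun i _ => Ideal.pow_mem_pow (hf i) _)

theorem skodaAux_cartier (p e : ℕ) (hp : p.Prime) {R : Type*} [CommRing R]
    {r : ℕ} (hr : 1 ≤ r) (f : Fin r → R) (m : ℕ) (h : r * p ^ e ≤ m + p ^ e) :
    cartierIdeal p e ((Ideal.span (Set.range f)) ^ (m + p ^ e)) =
      Ideal.span (Set.range f) * cartierIdeal p e ((Ideal.span (Set.range f)) ^ m) := by
  have hpow := skodaAux_pow_le hr f (p ^ e) m (Nat.one_le_pow _ _ hp.pos) h
  generalize Ideal.span (Set.range f) = I at hpow ⊢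
  apply le_antisymm
  · refine Ideal.span_le.2 ?_
    rintro _ ⟨φ, hφ, x, hx, rfl⟩
    have key : ∀ x ∈ Ideal.span {y | ∃ g ∈ I, y = g ^ p ^ e} * I ^ m,
        φ x ∈ I * cartierIdeal p e (I ^ m) := by
      intro x hx
      refine Submodule.mul_induction_on hx ?_ ?_
      · intro u hu v hv
        induction hu using Submodule.span_induction generalizing v with
        | mem u hu =>
          obtain ⟨g, hg, rfl⟩ := hu
          rw [hφ]
          exact Ideal.mul_mem_mul hg (Ideal.subset_span ⟨φ, hφ, v, hv, rfl⟩)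
        | zero => simp
        | add a b _ _ ha hb =>
          rw [add_mul, map_add]
          exact add_mem (ha v hv) (hb v hv)
        | smul c a _ ha =>
          rw [smul_eq_mul, mul_comm c a, mul_assoc]
          exact ha _ (Ideal.mul_mem_left _ _ hv)
      · intro a b ha hb
        rw [map_add]
        exact add_mem ha hb
    exact key x (hpow hx)
  · rw [Ideal.mul_le]
    intro g hg y hy
    induction hy using Submodule.span_induction with
    | mem y hy =>
      obtain ⟨φ, hφ, x, hx, rfl⟩ := hy
      refine Ideal.subset_span ⟨φ, hφ, g ^ p ^ e * x, ?_, hφ g x⟩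
      rw [add_comm m, pow_add]
      exact Ideal.mul_mem_mul (Ideal.pow_mem_pow hg _) hx
    | zero => simp
    | add a b _ _ ha hb =>
      rw [mul_add]
      exact add_mem ha hb
    | smul c a _ ha =>
      rw [smul_eq_mul, mul_left_comm]
      exact Ideal.mul_mem_left _ _ ha

/-- Skoda's theorem for test ideals (Proposition 2.5(b)). -/
theorem skoda_testIdeal (p : ℕ) (hp : p.Prime) (R : Type*) [CommRing R] [CharP R p]
    (r : ℕ) (hr : 1 ≤ r) (f : Fin r → R) (𝔞 : Ideal R)
    (h𝔞 : 𝔞 = Ideal.span (Set.range f))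
    (lam : ℝ) (hlam : (r : ℝ) ≤ lam) :
    testIdeal p 𝔞 lam = 𝔞 * testIdeal p 𝔞 (lam - 1) := by
  subst h𝔞
  unfold testIdeal
  simp only [Ideal.mul_iSup]
  refine iSup_congr fun e => iSup_congr fun _ => ?_
  have hp0 : (0 : ℝ) ≤ (p : ℝ) ^ e := by positivity
  have hr1 : (1 : ℝ) ≤ r := by exact_mod_cast hr
  have hn : ⌈lam * (p : ℝ) ^ e⌉₊ = ⌈(lam - 1) * (p : ℝ) ^ e⌉₊ + p ^ e := by
    rw [← Nat.ceil_add_natCast (mul_nonneg (by linarith) hp0)]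
    congr 1
    push_cast
    ring
  have hle : r * p ^ e ≤ ⌈lam * (p : ℝ) ^ e⌉₊ := by
    have h1 : ((r * p ^ e : ℕ) : ℝ) ≤ ⌈lam * (p : ℝ) ^ e⌉₊ := by
      refine le_trans ?_ (Nat.le_ceil _)
      push_cast
      exact mul_le_mul_of_nonneg_right hlam hp0
    exact_mod_cast h1
  rw [hn] at hle ⊢
  exact skodaAux_cartier p e hp hr f _ hle
end

section
/- Let p be a prime, e ≥ 1 an integer, and R a commutative ring of characteristic p such that F^e_*R (that is, R viewed as a module over itself via r • x = r^{p^e}·x) is a finitely generated free R-module. Then for every ideal I of R one has D^e·I = (C^e·I)^{[p^e]}. (Lemma 2.3(a).) -/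
/-- `D^e · I`: the ideal generated by all `ξ x` with `ξ` additive, linear over `p^e`-th powers,
and `x ∈ I`. -/
def diffIdeal (p e : ℕ) {R : Type*} [CommRing R] (I : Ideal R) : Ideal R :=
  Ideal.span {y | ∃ ξ : R →+ R, (∀ r x : R, ξ (r ^ p ^ e * x) = r ^ p ^ e * ξ x) ∧ ∃ x ∈ I, ξ x = y}

/-- `J^{[q]}`: the ideal generated by `q`-th powers of elements of `J`. -/
def bracketPower {R : Type*} [CommRing R] (J : Ideal R) (q : ℕ) : Ideal R :=
  Ideal.span ((fun x => x ^ q) '' (J : Set R))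

/-- Lemma 2.3(a): if `F^e_* R` is a finitely generated free `R`-module, then
`D^e · I = (C^e · I)^{[p^e]}`. -/
theorem diffIdeal_eq_bracketPower_cartierIdeal (p : ℕ) (hp : p.Prime)
    (e : ℕ) (he : 1 ≤ e) (R : Type*) [CommRing R] [CharP R p]
    (hfree : ∃ n : ℕ, ∃ b : Fin n → R, ∀ x : R, ∃! c : Fin n → R,
      x = ∑ i, c i ^ p ^ e * b i)
    (I : Ideal R) :
    diffIdeal p e I = bracketPower (cartierIdeal p e I) (p ^ e) := by
  haveI : Fact p.Prime := ⟨hp⟩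
  have hq : p ^ e ≠ 0 := pow_ne_zero _ hp.ne_zero
  apply le_antisymm
  · obtain ⟨n, b, hb⟩ := hfree
    choose c hc huniq using hb
    have hadd : ∀ x y, c (x + y) = c x + c y := by
      intro x y
      symm
      apply huniq
      simp only [Pi.add_apply, add_pow_char_pow, add_mul, Finset.sum_add_distrib]
      exact congrArg₂ (· + ·) (hc x) (hc y)
    have hsmul : ∀ r x, c (r ^ p ^ e * x) = fun i => r * c x i := by
      intro r x
      symm
      apply huniq
      simp only [mul_pow, mul_assoc, ← Finset.mul_sum]
      exact congrArg (r ^ p ^ e * ·) (hc x)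
    apply Ideal.span_le.2
    rintro y ⟨ξ, hξ, x, hx, rfl⟩
    have h1 : ξ x = ∑ i, c x i ^ p ^ e * ξ (b i) := by
      conv_lhs => rw [hc x]
      rw [map_sum]
      simp only [hξ]
    rw [SetLike.mem_coe, h1]
    refine Ideal.sum_mem _ fun i _ => Ideal.mul_mem_right _ _ ?_
    apply Ideal.subset_span
    refine ⟨c x i, ?_, rfl⟩
    apply Ideal.subset_span
    refine ⟨AddMonoidHom.mk' (fun x => c x i) (fun x y => by simp [hadd]), ?_, x, hx, rfl⟩
    intro r z
    simp [hsmul]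
  · apply Ideal.span_le.2
    rintro _ ⟨y, hy, rfl⟩
    change y ^ p ^ e ∈ diffIdeal p e I
    change y ∈ cartierIdeal p e I at hy
    unfold cartierIdeal at hy
    induction hy using Submodule.span_induction with
    | mem y h =>
      obtain ⟨φ, hφ, x, hx, rfl⟩ := h
      apply Ideal.subset_span
      refine ⟨AddMonoidHom.mk' (fun x => φ x ^ p ^ e)
        (fun x y => by simp [add_pow_char_pow]), ?_, x, hx, rfl⟩
      intro r z
      simp [hφ r z, mul_pow]
    | zero => rw [zero_pow hq]; exact Ideal.zero_mem _
    | add x y _ _ h1 h2 => rw [add_pow_char_pow]; exact Ideal.add_mem _ h1 h2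
    | smul a x _ h => rw [smul_eq_mul, mul_pow]; exact Ideal.mul_mem_left _ _ h
end
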